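/- Let D be an almost Dedekind domain and let I be a nonzero proper finitely generated ideal of D. Then the ideal function ν_I : Max(D) → ℕ is lower semicontinuous with respect to the constructible topology; that is, for every n ∈ ℕ the set {M ∈ Max(D) : ν_I(M) ≤ n} is closed (equivalently, {M ∈ Max(D) : ν_I(M) > n} is open) in Max(D) with the constructible topology. -/

import Mathlib

/-!
Common definitions: almost Dedekind domains, ideal functions, critical ideals,
the constructible topology on the maximal spectrum.
-/

open scoped Classical Topology

namespace ADPaper

variable (R : Type*) [CommRing R]

/-- The normalized valuation `v_M(x)` of an element `x` of `R` in the localization at the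
maximal ideal `M`: the largest `n` such that the image of `x` lies in the `n`-th power of the
maximal ideal of `R_M` (a junk value if no largest such `n` exists). -/
noncomputable def elemVal (M : MaximalSpectrum R) (x : R) : ℕ :=
  sSup {n : ℕ | algebraMap R (Localization.AtPrime M.asIdeal) x ∈
    IsLocalRing.maximalIdeal (Localization.AtPrime M.asIdeal) ^ n}

/-- The ideal function `ν_I(M) = v_M(I) = min { v_M(x) : x ∈ I, x ≠ 0 }`. -/
noncomputable def nu (I : Ideal R) (M : MaximalSpectrum R) : ℕ :=
  sInf (elemVal R M '' {x | x ∈ I ∧ x ≠ 0})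

/-- `R` is an almost Dedekind domain: the localization at every maximal ideal is a
discrete valuation ring. (The requirement that `R` is not a field is stated separately
where needed.) -/
def AlmostDedekind [IsDomain R] : Prop :=
  ∀ M : MaximalSpectrum R, IsDiscreteValuationRing (Localization.AtPrime M.asIdeal)

/-- An ideal `M` of a commutative ring is critical if it is maximal and contains no nonzero
finitely generated radical ideal. -/
def IsCritical (M : Ideal R) : Prop :=
  M.IsMaximal ∧ ∀ J : Ideal R, J ≠ ⊥ → J.FG → J.IsRadical → ¬ J ≤ M

/-- `Crit R`: the set of critical maximal ideals, i.e. maximal ideals containing no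
nonzero finitely generated radical ideal. -/
def Crit : Set (MaximalSpectrum R) :=
  {M | ∀ J : Ideal R, J ≠ ⊥ → J.FG → J.IsRadical → ¬ J ≤ M.asIdeal}

/-- `CritN R n`: the set of `n`-critical maximal ideals, i.e. maximal ideals containing no
nonzero finitely generated ideal whose ideal function is bounded by `n`. -/
def CritN (n : ℕ) : Set (MaximalSpectrum R) :=
  {M | ∀ J : Ideal R, J ≠ ⊥ → J.FG → (∀ N, nu R J N ≤ n) → ¬ J ≤ M.asIdeal}

/-- `CritOmega R`: the set of `ω`-critical maximal ideals, i.e. maximal ideals containing no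
nonzero finitely generated ideal whose ideal function is bounded. -/
def CritOmega : Set (MaximalSpectrum R) :=
  {M | ∀ J : Ideal R, J ≠ ⊥ → J.FG → (∃ n : ℕ, ∀ N, nu R J N ≤ n) → ¬ J ≤ M.asIdeal}

/-- The constructible topology on the maximal spectrum: generated by the sets
`V(J) = {M | J ≤ M}` and their complements, for `J` finitely generated. -/
def constrTop : TopologicalSpace (MaximalSpectrum R) :=
  TopologicalSpace.generateFrom
    {S | ∃ J : Ideal R, J.FG ∧ (S = {M | J ≤ M.asIdeal} ∨ S = {M | ¬ J ≤ M.asIdeal})}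

variable [IsDomain R]

/-- The localization `R_M` regarded as a subalgebra of the fraction field. -/
noncomputable def locSubalgebra (M : MaximalSpectrum R) : Subalgebra R (FractionRing R) :=
  Localization.subalgebra (FractionRing R) M.asIdeal.primeCompl
    (fun _s hs => mem_nonZeroDivisors_of_ne_zero fun h => hs (h ▸ M.asIdeal.zero_mem))

/-- The overring `⋂ {R_M : M ∈ X}` of `R` inside the fraction field (equal to the whole
fraction field when `X = ∅`). -/
noncomputable def interLoc (X : Set (MaximalSpectrum R)) : Subalgebra R (FractionRing R) :=
  ⨅ M ∈ X, locSubalgebra R M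

/-- The valuation `v_M` extended to the fraction field: `v_M(a/s) = v_M(a) - v_M(s)`. -/
noncomputable def elemValK (M : MaximalSpectrum R) (x : FractionRing R) : ℤ :=
  (elemVal R M (IsLocalization.sec (nonZeroDivisors R) x).1 : ℤ) -
    (elemVal R M ((IsLocalization.sec (nonZeroDivisors R) x).2 : R) : ℤ)

/-- The ideal function of a fractional ideal. -/
noncomputable def nuK (I : FractionalIdeal (nonZeroDivisors R) (FractionRing R))
    (M : MaximalSpectrum R) : ℤ :=
  sInf (elemValK R M '' {x | x ∈ I ∧ x ≠ 0})

end ADPaper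

namespace ADPaper

theorem lt_elemVal_iff {R : Type*} [CommRing R] [IsDomain R] (hAD : AlmostDedekind R)
    (M : MaximalSpectrum R) {x : R} (hx : x ≠ 0) (n : ℕ) :
    n < elemVal R M x ↔ algebraMap R (Localization.AtPrime M.asIdeal) x ∈
      IsLocalRing.maximalIdeal (Localization.AtPrime M.asIdeal) ^ (n + 1) := by
  have := hAD M
  set S : Set ℕ := {n : ℕ | algebraMap R (Localization.AtPrime M.asIdeal) x ∈
    IsLocalRing.maximalIdeal (Localization.AtPrime M.asIdeal) ^ n} with hS
  have hx' : algebraMap R (Localization.AtPrime M.asIdeal) x ≠ 0 := fun h =>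
    hx ((IsLocalization.injective _ M.asIdeal.primeCompl_le_nonZeroDivisors)
      (h.trans (map_zero _).symm))
  have hbdd : BddAbove S := by
    by_contra hb
    apply hx'
    have hmem : algebraMap R (Localization.AtPrime M.asIdeal) x ∈
        ⨅ i : ℕ, IsLocalRing.maximalIdeal (Localization.AtPrime M.asIdeal) ^ i := by
      refine (Submodule.mem_iInf _).2 fun i => ?_
      obtain ⟨j, hj, hij⟩ := not_bddAbove_iff.1 hb i
      exact Ideal.pow_le_pow_right hij.le hj
    rwa [Ideal.iInf_pow_eq_bot_of_isLocalRing _ (IsLocalRing.maximalIdeal.isMaximal _).ne_top,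
      Ideal.mem_bot] at hmem
  have hne : S.Nonempty := ⟨0, by simp [hS]⟩
  constructor
  · intro h
    exact Ideal.pow_le_pow_right h (Nat.sSup_mem hne hbdd)
  · intro h
    exact Nat.lt_of_succ_le (le_csSup hbdd h)

theorem lt_nu_iff {R : Type*} [CommRing R] [IsDomain R] (hAD : AlmostDedekind R)
    {I : Ideal R} (hI : I ≠ ⊥) (M : MaximalSpectrum R) (n : ℕ) :
    n < nu R I M ↔ I ≤ (IsLocalRing.maximalIdeal (Localization.AtPrime M.asIdeal) ^ (n + 1)).comap
      (algebraMap R (Localization.AtPrime M.asIdeal)) := by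
  constructor
  · intro h x hxI
    by_cases hx : x = 0
    · simp [hx]
    · exact (lt_elemVal_iff hAD M hx n).1 (h.trans_le (Nat.sInf_le ⟨x, ⟨hxI, hx⟩, rfl⟩))
  · intro h
    obtain ⟨y, hyI, hy⟩ := Submodule.exists_mem_ne_zero_of_ne_bot hI
    obtain ⟨x, ⟨hxI, hx⟩, hval⟩ :=
      Nat.sInf_mem (s := elemVal R M '' {x | x ∈ I ∧ x ≠ 0}) ⟨_, y, ⟨hyI, hy⟩, rfl⟩
    exact ((lt_elemVal_iff hAD M hx n).2 (h hxI)).trans_eq hval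

/-- Every maximal ideal `M` of an almost Dedekind domain contains an element that generates the
maximal ideal of the localization at `M`. -/
theorem exists_maximalIdeal_eq_span_algebraMap {R : Type*} [CommRing R] [IsDomain R]
    (hAD : AlmostDedekind R) (M : MaximalSpectrum R) :
    ∃ a ∈ M.asIdeal, IsLocalRing.maximalIdeal (Localization.AtPrime M.asIdeal) =
      Ideal.span {algebraMap R (Localization.AtPrime M.asIdeal) a} := by
  have := hAD M
  obtain ⟨ϖ, hϖ⟩ := IsDiscreteValuationRing.exists_irreducible (Localization.AtPrime M.asIdeal)
  obtain ⟨⟨a, s⟩, hs⟩ := IsLocalization.surj M.asIdeal.primeCompl ϖ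
  have hspan : IsLocalRing.maximalIdeal (Localization.AtPrime M.asIdeal) =
      Ideal.span {algebraMap R (Localization.AtPrime M.asIdeal) a} := by
    rw [hϖ.maximalIdeal_eq, ← hs, Ideal.span_singleton_mul_right_unit
      (IsLocalization.map_units (Localization.AtPrime M.asIdeal) s)]
  refine ⟨a, ?_, hspan⟩
  rw [← IsLocalization.AtPrime.to_map_mem_maximal_iff (Localization.AtPrime M.asIdeal) M.asIdeal,
    hspan]
  exact Ideal.mem_span_singleton_self _

theorem exists_mul_eq_pow_mul {R : Type*} [CommRing R] [IsDomain R] (M : MaximalSpectrum R)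
    {a x : R} {k : ℕ} (hspan : IsLocalRing.maximalIdeal (Localization.AtPrime M.asIdeal) =
      Ideal.span {algebraMap R (Localization.AtPrime M.asIdeal) a})
    (hx : algebraMap R (Localization.AtPrime M.asIdeal) x ∈
      IsLocalRing.maximalIdeal (Localization.AtPrime M.asIdeal) ^ k) :
    ∃ s ∉ M.asIdeal, ∃ r, s * x = a ^ k * r := by
  rw [hspan, Ideal.span_singleton_pow, Ideal.mem_span_singleton] at hx
  obtain ⟨z, hz⟩ := hx
  obtain ⟨⟨r, s⟩, hs⟩ := IsLocalization.surj M.asIdeal.primeCompl z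
  refine ⟨s, s.2, r, IsLocalization.injective (Localization.AtPrime M.asIdeal)
    M.asIdeal.primeCompl_le_nonZeroDivisors ?_⟩
  rw [map_mul, map_mul, map_pow, hz, ← hs]
  ring

theorem algebraMap_mem_maximalIdeal_pow {R : Type*} [CommRing R] (N : MaximalSpectrum R)
    {a s x r : R} {k : ℕ} (ha : a ∈ N.asIdeal) (hs : s ∉ N.asIdeal) (h : s * x = a ^ k * r) :
    algebraMap R (Localization.AtPrime N.asIdeal) x ∈
      IsLocalRing.maximalIdeal (Localization.AtPrime N.asIdeal) ^ k := by
  have hu : IsUnit (algebraMap R (Localization.AtPrime N.asIdeal) s) :=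
    IsLocalization.map_units (Localization.AtPrime N.asIdeal) (⟨s, hs⟩ : N.asIdeal.primeCompl)
  rw [← Ideal.unit_mul_mem_iff_mem _ hu, ← map_mul, h, map_mul, map_pow]
  exact Ideal.mul_mem_right _ _ (Ideal.pow_mem_pow
    ((IsLocalization.AtPrime.to_map_mem_maximal_iff _ N.asIdeal a).2 ha) k)

theorem isOpen_setOf_lt_nu {R : Type*} [CommRing R] [IsDomain R] (hAD : AlmostDedekind R)
    {I : Ideal R} (hfg : I.FG) (hI : I ≠ ⊥) (n : ℕ) :
    IsOpen[constrTop R] {M : MaximalSpectrum R | n < nu R I M} := by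
  let := constrTop R
  refine isOpen_iff_forall_mem_open.2 fun M hM => ?_
  obtain ⟨T, rfl⟩ := hfg
  have hM' := (lt_nu_iff hAD hI M n).1 hM
  obtain ⟨a, ha, hspan⟩ := exists_maximalIdeal_eq_span_algebraMap hAD M
  choose! s hs r hr using fun x (hx : x ∈ T) =>
    exists_mul_eq_pow_mul M hspan (Ideal.mem_comap.1 (hM' (Ideal.subset_span hx)))
  have hopen₁ : IsOpen {N : MaximalSpectrum R | Ideal.span {a} ≤ N.asIdeal} :=
    TopologicalSpace.isOpen_generateFrom_of_mem
      ⟨Ideal.span {a}, Submodule.fg_span_singleton a, Or.inl rfl⟩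
  have hopen₂ : IsOpen {N : MaximalSpectrum R | ¬ Ideal.span {∏ x ∈ T, s x} ≤ N.asIdeal} :=
    TopologicalSpace.isOpen_generateFrom_of_mem
      ⟨Ideal.span {∏ x ∈ T, s x}, Submodule.fg_span_singleton _, Or.inr rfl⟩
  refine ⟨_, ?_, hopen₁.inter hopen₂, ?_, ?_⟩
  · rintro N ⟨haN, hsN⟩
    simp only [Set.mem_ofPred_eq, Ideal.span_singleton_le_iff_mem] at haN hsN
    refine (lt_nu_iff hAD hI N n).2 (Ideal.span_le.2 fun x hx => ?_)
    exact algebraMap_mem_maximalIdeal_pow N haN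
      (fun h => hsN (Ideal.mem_of_dvd _ (Finset.dvd_prod_of_mem s hx) h)) (hr x hx)
  · simpa using ha
  · have hprod : ∏ x ∈ T, s x ∈ M.asIdeal.primeCompl := prod_mem fun x hx => hs x hx
    simpa only [Set.mem_ofPred_eq, Ideal.span_singleton_le_iff_mem,
      Ideal.mem_primeCompl_iff] using hprod

/-- Let `D` be an almost Dedekind domain and `I` a nonzero proper finitely
generated ideal. Then `ν_I` is lower semicontinuous for the constructible topology: for
every `n ∈ ℕ` the set `{M : ν_I(M) ≤ n}` is closed (equivalently, `{M : ν_I(M) > n}` is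
open). -/
theorem statement8 (R : Type*) [CommRing R] [IsDomain R] (hR : ¬ IsField R)
    (hAD : AlmostDedekind R) (I : Ideal R) (hfg : I.FG) (hI : I ≠ ⊥) (hItop : I ≠ ⊤) :
    ∀ n : ℕ, IsClosed[constrTop R] {M : MaximalSpectrum R | nu R I M ≤ n} ∧
      IsOpen[constrTop R] {M : MaximalSpectrum R | n < nu R I M} := by
  intro n
  let := constrTop R
  have hopen := isOpen_setOf_lt_nu hAD hfg hI n
  refine ⟨⟨?_⟩, hopen⟩
  simpa only [Set.compl_ofPred, not_le] using hopen

end ADPaper
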